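/- E-process pricing formula: for an arbitrary subset A ⊆ Ω, μ*(A) = inf { c ∈ (0,1] : there exists a 𝒫-e-process (E_t)_{t ∈ ℕ} with liminf_{t→∞} c·E_t(ω) ≥ 1 for every ω ∈ A } = inf { c ∈ (0,1] : there exists a 𝒫-e-process (E_t)_{t ∈ ℕ} with sup_{t ∈ ℕ} c·E_t(ω) ≥ 1 for every ω ∈ A }. -/

import Mathlib

open MeasureTheory Filter ENNReal

/-- A stopping time with values in `ℕ∞ = ℕ ∪ {∞}` with respect to a filtration `F`:
`{ω | τ ω ≤ t}` is `F t`-measurable for every `t ∈ ℕ`. -/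
def IsStopTime {Ω : Type*} {m : MeasurableSpace Ω} (F : Filtration ℕ m) (τ : Ω → ℕ∞) : Prop :=
  ∀ t : ℕ, MeasurableSet[F t] {ω | τ ω ≤ (t : ℕ∞)}

/-- The inverse-capital outer measure associated with a family `Ps` of measures:
`μ*(A) = inf { sup_{P ∈ Ps} P(τ < ∞) : τ a stopping time with A ⊆ {τ < ∞} }`. -/
noncomputable def invCap {Ω : Type*} {m : MeasurableSpace Ω} (F : Filtration ℕ m)
    (Ps : Set (Measure Ω)) (A : Set Ω) : ℝ≥0∞ :=
  ⨅ (τ : Ω → ℕ∞) (_ : IsStopTime F τ ∧ A ⊆ {ω | τ ω ≠ ⊤}),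
    ⨆ P ∈ Ps, P {ω | τ ω ≠ ⊤}


/-- The value `E_τ` of a process at a stopping time `τ`, defined as `limsup_{t→∞} E_t`
on the event `{τ = ∞}`. -/
noncomputable def stopVal {Ω : Type*} (E : ℕ → Ω → ℝ≥0∞) (τ : Ω → ℕ∞) (ω : Ω) : ℝ≥0∞ :=
  if h : τ ω = ⊤ then Filter.limsup (fun t => E t ω) Filter.atTop
  else E ((τ ω).untop h) ω

/-- A `Ps`-e-process: a `[0,∞)`-valued adapted process `E` such that `∫ E_τ dP ≤ 1` for every
`P ∈ Ps` and every stopping time `τ`. -/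
def IsEProcess {Ω : Type*} {m : MeasurableSpace Ω} (F : Filtration ℕ m)
    (Ps : Set (Measure Ω)) (E : ℕ → Ω → ℝ≥0∞) : Prop :=
  (∀ t ω, E t ω ≠ ⊤) ∧ (∀ t, Measurable[F t] (E t)) ∧
    ∀ P ∈ Ps, ∀ τ : Ω → ℕ∞, IsStopTime F τ → ∫⁻ ω, stopVal E τ ω ∂P ≤ 1

open Classical in
/-- The first time at which the process `X` exceeds the level `r`. -/
noncomputable def exceedTime {Ω : Type*} (X : ℕ → Ω → ℝ≥0∞) (r : ℝ≥0∞) (ω : Ω) : ℕ∞ :=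
  if h : ∃ t, r < X t ω then (Nat.find h : ℕ∞) else ⊤

theorem exceedTime_ne_top_iff {Ω : Type*} {X : ℕ → Ω → ℝ≥0∞} {r : ℝ≥0∞} {ω : Ω} :
    exceedTime X r ω ≠ ⊤ ↔ ∃ t, r < X t ω := by
  unfold exceedTime
  split_ifs with h <;> simp [h]

theorem exceedTime_le_iff {Ω : Type*} {X : ℕ → Ω → ℝ≥0∞} {r : ℝ≥0∞} {ω : Ω} {t : ℕ} :
    exceedTime X r ω ≤ t ↔ ∃ s ≤ t, r < X s ω := by
  classical
  unfold exceedTime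
  split_ifs with h
  · rw [Nat.cast_le, Nat.find_le_iff]
  · simp only [top_le_iff, ENat.natCast_ne_top, false_iff]
    rintro ⟨s, -, hs⟩
    exact h ⟨s, hs⟩

theorem isStopTime_exceedTime {Ω : Type*} {m : MeasurableSpace Ω} {F : Filtration ℕ m}
    {X : ℕ → Ω → ℝ≥0∞} (hX : ∀ t, Measurable[F t] (X t)) (r : ℝ≥0∞) :
    IsStopTime F (exceedTime X r) := by
  intro t
  have h : {ω | exceedTime X r ω ≤ t} = ⋃ s ∈ Set.Iic t, X s ⁻¹' Set.Ioi r := by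
    ext ω
    simp [exceedTime_le_iff]
  rw [h]
  exact MeasurableSet.biUnion (Set.to_countable _)
    fun s hs => F.mono hs _ (hX s measurableSet_Ioi)

theorem lt_of_exceedTime_eq_coe {Ω : Type*} {X : ℕ → Ω → ℝ≥0∞} {r : ℝ≥0∞} {ω : Ω} {t : ℕ}
    (h : exceedTime X r ω = t) : r < X t ω := by
  classical
  unfold exceedTime at h
  split_ifs at h with hex
  · rw [← Nat.cast_inj.mp h]
    exact Nat.find_spec hex
  · exact absurd h.symm (ENat.natCast_ne_top t)

theorem stopVal_of_eq_coe {Ω : Type*} {E : ℕ → Ω → ℝ≥0∞} {τ : Ω → ℕ∞} {ω : Ω} {t : ℕ}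
    (h : τ ω = t) : stopVal E τ ω = E t ω := by
  have hne : τ ω ≠ ⊤ := h ▸ ENat.natCast_ne_top t
  have hu : (τ ω).untop hne = t := WithTop.coe_injective ((WithTop.coe_untop _ hne).trans h)
  rw [stopVal, dif_neg hne, hu]

theorem stopVal_le_of_forall_le {Ω : Type*} {E : ℕ → Ω → ℝ≥0∞} {τ : Ω → ℕ∞} {ω : Ω} {b : ℝ≥0∞}
    (h : ∀ t, E t ω ≤ b) : stopVal E τ ω ≤ b := by
  unfold stopVal
  split_ifs
  · exact limsup_le_of_le (h := Eventually.of_forall h)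
  · exact h _

theorem IsStopTime.measurableSet_ne_top {Ω : Type*} {m : MeasurableSpace Ω}
    {F : Filtration ℕ m} {τ : Ω → ℕ∞} (hτ : IsStopTime F τ) : MeasurableSet {ω | τ ω ≠ ⊤} := by
  have h : {ω | τ ω ≠ ⊤} = ⋃ t : ℕ, {ω | τ ω ≤ t} := by
    ext ω
    simp only [Set.mem_ofPred_eq, Set.mem_iUnion]
    exact ⟨fun h => ⟨(τ ω).toNat, (ENat.natCast_toNat h).ge⟩,
      fun ⟨t, ht⟩ => ne_top_of_le_ne_top (ENat.natCast_ne_top t) ht⟩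
  rw [h]
  exact MeasurableSet.iUnion fun t => F.le t _ (hτ t)

/-- The all-or-nothing bet on `τ < ∞` is an e-process with payoff `c⁻¹` as soon as
`c` dominates the probability of `τ < ∞`. -/
theorem isEProcess_indicator {Ω : Type*} {m : MeasurableSpace Ω} {F : Filtration ℕ m}
    {Ps : Set (Measure Ω)} {τ : Ω → ℕ∞} (hτ : IsStopTime F τ) {c : ℝ≥0∞} (hc : c ≠ 0)
    (h : ∀ P ∈ Ps, P {ω | τ ω ≠ ⊤} ≤ c) :
    IsEProcess F Ps fun t => {ω | τ ω ≤ t}.indicator fun _ => c⁻¹ := by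
  refine ⟨fun t ω => ?_, fun t => measurable_const.indicator (hτ t), fun P hP σ _ => ?_⟩
  · by_cases hω : τ ω ≤ t <;> simp [Set.indicator, hω, hc]
  · calc ∫⁻ ω, stopVal (fun t => {ω | τ ω ≤ t}.indicator fun _ => c⁻¹) σ ω ∂P
        ≤ ∫⁻ ω, {ω | τ ω ≠ ⊤}.indicator (fun _ => c⁻¹) ω ∂P := by
          refine lintegral_mono fun ω => stopVal_le_of_forall_le fun t => ?_
          exact Set.indicator_le_indicator_of_subset
            (fun ω' h' => ne_top_of_le_ne_top (ENat.natCast_ne_top t) h') (fun _ => zero_le) ω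
      _ = c⁻¹ * P {ω | τ ω ≠ ⊤} := lintegral_indicator_const hτ.measurableSet_ne_top _
      _ ≤ c⁻¹ * c := by gcongr; exact h P hP
      _ ≤ 1 := ENNReal.inv_mul_le_one c

theorem sInf_liminf_le_invCap {Ω : Type*} {m : MeasurableSpace Ω} (F : Filtration ℕ m)
    (Ps : Set (Measure Ω)) (hprob : ∀ P ∈ Ps, IsProbabilityMeasure P) (A : Set Ω) :
    sInf {c : ℝ≥0∞ | c ∈ Set.Ioc 0 1 ∧ ∃ E : ℕ → Ω → ℝ≥0∞, IsEProcess F Ps E ∧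
        ∀ ω ∈ A, 1 ≤ Filter.liminf (fun t => c * E t ω) Filter.atTop} ≤ invCap F Ps A := by
  refine le_iInf₂ fun τ ⟨hτ, hA⟩ => le_of_forall_gt_imp_ge_of_dense fun b hb => ?_
  have hc0 : min b 1 ≠ 0 := (lt_min (zero_le.trans_lt hb) one_pos).ne'
  have hctop : min b 1 ≠ ⊤ := ((min_le_right b 1).trans_lt one_lt_top).ne
  refine le_trans (sInf_le ?_) (min_le_left b 1)
  refine ⟨⟨pos_iff_ne_zero.mpr hc0, min_le_right _ _⟩, _,
    isEProcess_indicator hτ hc0 fun P hP => le_min ?_ ?_, fun ω hω => ?_⟩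
  · exact (le_iSup₂ (f := fun P (_ : P ∈ Ps) => P {ω | τ ω ≠ ⊤}) P hP).trans hb.le
  · have := hprob P hP
    exact prob_le_one
  · refine le_liminf_of_le (h := ?_)
    filter_upwards [eventually_ge_atTop (τ ω).toNat] with t ht
    have hle : τ ω ≤ t := by
      rw [← ENat.natCast_toNat (hA hω)]
      exact_mod_cast ht
    simp [Set.indicator, hle, ENNReal.mul_inv_cancel hc0 hctop]

/-- Ville's inequality for e-processes, in terms of the first exceedance time. -/
theorem IsEProcess.mul_measure_exceedTime_le {Ω : Type*} {m : MeasurableSpace Ω}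
    {F : Filtration ℕ m} {Ps : Set (Measure Ω)} {E : ℕ → Ω → ℝ≥0∞} (hE : IsEProcess F Ps E)
    {P : Measure Ω} (hP : P ∈ Ps) {c : ℝ≥0∞} (hc : c ≠ ⊤) (r : ℝ≥0∞) :
    r * P {ω | exceedTime (fun t ω => c * E t ω) r ω ≠ ⊤} ≤ c := by
  set τ := exceedTime (fun t ω => c * E t ω) r with hτdef
  have hτ : IsStopTime F τ := isStopTime_exceedTime (fun t => (hE.2.1 t).const_mul c) r
  calc r * P {ω | τ ω ≠ ⊤}
      = ∫⁻ ω, {ω | τ ω ≠ ⊤}.indicator (fun _ => r) ω ∂P :=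
        (lintegral_indicator_const hτ.measurableSet_ne_top r).symm
    _ ≤ ∫⁻ ω, c * stopVal E τ ω ∂P := by
        refine lintegral_mono fun ω => Set.indicator_apply_le' (fun hω => ?_) fun _ => zero_le
        have hcoe : τ ω = (τ ω).toNat := (ENat.natCast_toNat hω).symm
        rw [stopVal_of_eq_coe hcoe]
        exact (lt_of_exceedTime_eq_coe hcoe).le
    _ = c * ∫⁻ ω, stopVal E τ ω ∂P := lintegral_const_mul' c _ hc
    _ ≤ c * 1 := by gcongr; exact hE.2.2 P hP τ hτ
    _ = c := mul_one c

theorem invCap_le_sInf_iSup {Ω : Type*} {m : MeasurableSpace Ω} (F : Filtration ℕ m)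
    (Ps : Set (Measure Ω)) (A : Set Ω) :
    invCap F Ps A ≤
      sInf {c : ℝ≥0∞ | c ∈ Set.Ioc 0 1 ∧ ∃ E : ℕ → Ω → ℝ≥0∞, IsEProcess F Ps E ∧
        ∀ ω ∈ A, 1 ≤ ⨆ t : ℕ, c * E t ω} := by
  refine le_sInf fun c ⟨⟨_, hc1⟩, E, hE, hA⟩ => ?_
  have hc : c ≠ ⊤ := ne_top_of_le_ne_top one_ne_top hc1
  refine ENNReal.le_of_forall_lt_one_mul_le fun r hr => ?_
  set τ := exceedTime (fun t ω => c * E t ω) r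
  have hle : invCap F Ps A ≤ ⨆ P ∈ Ps, P {ω | τ ω ≠ ⊤} :=
    iInf₂_le τ ⟨isStopTime_exceedTime (fun t => (hE.2.1 t).const_mul c) r, fun ω hω =>
      exceedTime_ne_top_iff.mpr (lt_iSup_iff.mp (hr.trans_le (hA ω hω)))⟩
  calc r * invCap F Ps A ≤ r * ⨆ P ∈ Ps, P {ω | τ ω ≠ ⊤} := by gcongr
    _ = ⨆ P ∈ Ps, r * P {ω | τ ω ≠ ⊤} := by simp only [ENNReal.mul_iSup]
    _ ≤ c := iSup₂_le fun P hP => hE.mul_measure_exceedTime_le hP hc r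

theorem sInf_iSup_le_sInf_liminf {Ω : Type*} {m : MeasurableSpace Ω} (F : Filtration ℕ m)
    (Ps : Set (Measure Ω)) (A : Set Ω) :
    sInf {c : ℝ≥0∞ | c ∈ Set.Ioc 0 1 ∧ ∃ E : ℕ → Ω → ℝ≥0∞, IsEProcess F Ps E ∧
        ∀ ω ∈ A, 1 ≤ ⨆ t : ℕ, c * E t ω} ≤
      sInf {c : ℝ≥0∞ | c ∈ Set.Ioc 0 1 ∧ ∃ E : ℕ → Ω → ℝ≥0∞, IsEProcess F Ps E ∧
        ∀ ω ∈ A, 1 ≤ Filter.liminf (fun t => c * E t ω) Filter.atTop} :=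
  sInf_le_sInf fun _ ⟨hc, E, hE, hA⟩ =>
    ⟨hc, E, hE, fun ω hω => ((hA ω hω).trans liminf_le_limsup).trans limsup_le_iSup⟩

/-- E-process pricing formula: `μ*(A)` equals the infimum over starting capitals `c ∈ (0,1]`
from which an e-process can reach `1` on `A`, both in the `liminf` and the `sup` sense. -/
theorem eprocess_pricing {Ω : Type*} {m : MeasurableSpace Ω} (F : Filtration ℕ m)
    (hgen : m = ⨆ t : ℕ, (F t : MeasurableSpace Ω))
    (Ps : Set (Measure Ω)) (hprob : ∀ P ∈ Ps, IsProbabilityMeasure P) (A : Set Ω) :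
    invCap F Ps A =
      sInf {c : ℝ≥0∞ | c ∈ Set.Ioc 0 1 ∧ ∃ E : ℕ → Ω → ℝ≥0∞, IsEProcess F Ps E ∧
        ∀ ω ∈ A, 1 ≤ Filter.liminf (fun t => c * E t ω) Filter.atTop} ∧
    invCap F Ps A =
      sInf {c : ℝ≥0∞ | c ∈ Set.Ioc 0 1 ∧ ∃ E : ℕ → Ω → ℝ≥0∞, IsEProcess F Ps E ∧
        ∀ ω ∈ A, 1 ≤ ⨆ t : ℕ, c * E t ω} := by
  have h₁ := invCap_le_sInf_iSup F Ps A
  have h₂ := sInf_iSup_le_sInf_liminf F Ps A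
  have h₃ := sInf_liminf_le_invCap F Ps hprob A
  exact ⟨le_antisymm (h₁.trans h₂) h₃, le_antisymm h₁ (h₂.trans h₃)⟩
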